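/- Suppose the CFL condition α·sup_{x∈Ω}|f(x)| + 2βν < 1 holds, g : ℝ×ℝ → ℝ satisfies 0 ≤ g ≤ G for a constant G ≥ 0, λ > 0, ν > 0, and (M̄_{i,j}) is any family of reals. Let (Ψ_{i,j}) be the solution of the explicit backward finite-difference scheme with terminal data Ψ_{i,N_t} = exp(-v_T(x_i)/λ). Then for all i and all j = 0,…,N_t one has Γ_min ≤ Ψ_{i,j} ≤ Γ_max, where Γ_max := sup_{x∈Ω} exp(-v_T(x)/λ) and Γ_min := exp(-(T/λ)G)·inf_{x∈Ω} exp(-v_T(x)/λ) > 0. In particular Γ_min and Γ_max do not depend on (M̄_{i,j}), Δx, or Δt. -/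

import Mathlib

theorem stmt3_step (a b d c D P p q r L S : ℝ) (ha : 0 ≤ a) (hb : 0 ≤ b) (hd : 0 ≤ d)
    (hs : a + b + d = 1) (hc : 0 ≤ c) (hcD : c ≤ D) (hL : 0 ≤ L)
    (hP : (1 + c) * P = a * p + b * q + d * r)
    (hp : L ≤ p ∧ p ≤ S) (hq : L ≤ q ∧ q ≤ S) (hr : L ≤ r ∧ r ≤ S) :
    L * Real.exp (-D) ≤ P ∧ P ≤ S := by
  have h1 : L ≤ (1 + c) * P := by
    rw [hP]
    have e : L = a * L + b * L + d * L := by rw [← add_mul, ← add_mul, hs, one_mul]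
    have := mul_le_mul_of_nonneg_left hp.1 ha
    have := mul_le_mul_of_nonneg_left hq.1 hb
    have := mul_le_mul_of_nonneg_left hr.1 hd
    linarith
  have h2 : (1 + c) * P ≤ S := by
    rw [hP]
    have e : S = a * S + b * S + d * S := by rw [← add_mul, ← add_mul, hs, one_mul]
    have := mul_le_mul_of_nonneg_left hp.2 ha
    have := mul_le_mul_of_nonneg_left hq.2 hb
    have := mul_le_mul_of_nonneg_left hr.2 hd
    linarith
  have hc1 : 0 < 1 + c := by linarith
  have hP0 : 0 ≤ P := by
    by_contra h
    have := mul_neg_of_pos_of_neg hc1 (not_le.mp h)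
    linarith
  constructor
  · have h3 : 1 + c ≤ Real.exp D := by
      have := Real.add_one_le_exp D
      linarith
    rw [Real.exp_neg, ← div_eq_mul_inv, div_le_iff₀ (Real.exp_pos D)]
    have := mul_le_mul_of_nonneg_right h3 hP0
    linarith
  · have := mul_nonneg hc hP0
    linarith

/-- Discrete maximum principle for the explicit backward finite-difference
scheme: under the CFL condition and `0 ≤ g ≤ G`, the scheme solution with
terminal data `exp(-v_T/λ)` satisfies `Γ_min ≤ Ψ_{i,j} ≤ Γ_max`, where
`Γ_max = sup_Ω exp(-v_T/λ)` and `Γ_min = exp(-(T/λ)G)·inf_Ω exp(-v_T/λ)`,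
independently of the data `M̄`, `Δx` and `Δt`. -/
theorem stmt3 (T : ℝ) (hT : 0 < T) (Nx Nt : ℕ) (hNx : 1 ≤ Nx) (hNt : 1 ≤ Nt)
    (f : ℝ → ℝ) (hf : Continuous f) (hfper : Function.Periodic f 2)
    (vT : ℝ → ℝ) (hvT : Continuous vT) (hvTper : Function.Periodic vT 2)
    (g : ℝ → ℝ → ℝ) (G : ℝ) (hG : 0 ≤ G)
    (hg : ∀ y r : ℝ, 0 ≤ g y r ∧ g y r ≤ G)
    (lam ν : ℝ) (hlam : 0 < lam) (hν : 0 < ν)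
    -- grid parameters
    (Δx Δt α β : ℝ)
    (hΔx : Δx = 1 / (Nx : ℝ)) (hΔt : Δt = T / (Nt : ℝ))
    (hα : α = Δt / Δx) (hβ : β = Δt / Δx ^ 2)
    (x : ZMod (2 * Nx + 1) → ℝ) (hx : ∀ i, x i = (ZMod.val i : ℝ) * Δx)
    -- CFL condition
    (hCFL : α * sSup ((fun y => |f y|) '' Set.Icc (-1 : ℝ) 1) + 2 * β * ν < 1)
    -- arbitrary data M̄ and the scheme solution Ψ
    (M Ψ : ZMod (2 * Nx + 1) → ℕ → ℝ)
    (hterm : ∀ i, Ψ i Nt = Real.exp (-(vT (x i)) / lam))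
    (hscheme : ∀ j, 1 ≤ j → j ≤ Nt → ∀ i,
      (Ψ i (j - 1) - Ψ i j) / Δt =
        max (f (x i)) 0 * ((Ψ (i + 1) j - Ψ i j) / Δx)
          + min (f (x i)) 0 * ((Ψ i j - Ψ (i - 1) j) / Δx)
          + ν * ((Ψ (i + 1) j - 2 * Ψ i j + Ψ (i - 1) j) / Δx ^ 2)
          - (1 / lam) * g (x i) (M i j) * Ψ i (j - 1)) :
    ∀ i, ∀ j ≤ Nt,
      (0 < Real.exp (-(T / lam) * G)
            * sInf ((fun y => Real.exp (-(vT y) / lam)) '' Set.Icc (-1 : ℝ) 1)) ∧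
      Real.exp (-(T / lam) * G)
          * sInf ((fun y => Real.exp (-(vT y) / lam)) '' Set.Icc (-1 : ℝ) 1) ≤ Ψ i j ∧
      Ψ i j ≤ sSup ((fun y => Real.exp (-(vT y) / lam)) '' Set.Icc (-1 : ℝ) 1) := by
  have hNt0 : (0 : ℝ) < Nt := by exact_mod_cast hNt
  have hNx0 : (0 : ℝ) < Nx := by exact_mod_cast hNx
  have hΔx0 : 0 < Δx := by rw [hΔx]; positivity
  have hΔt0 : 0 < Δt := by rw [hΔt]; positivity
  have hα0 : 0 < α := by rw [hα]; positivity
  have hβ0 : 0 < β := by rw [hβ]; positivity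
  have hper : ∀ (h : ℝ → ℝ), Function.Periodic h 2 → ∀ y,
      h y ∈ h '' Set.Icc (-1 : ℝ) 1 := by
    intro h hh y
    obtain ⟨z, hz, hyz⟩ := hh.exists_mem_Ico (by norm_num) y (-1)
    refine ⟨z, ⟨hz.1, ?_⟩, hyz.symm⟩
    have := hz.2
    linarith
  set E : ℝ → ℝ := fun y => Real.exp (-(vT y) / lam) with hE
  have hEc : Continuous E := by rw [hE]; fun_prop
  have hEper : Function.Periodic E 2 := by
    intro y
    simp only [hE, hvTper y]
  have hEcomp : IsCompact (E '' Set.Icc (-1 : ℝ) 1) := isCompact_Icc.image hEc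
  have hEne : (E '' Set.Icc (-1 : ℝ) 1).Nonempty := ⟨E 0, 0, by norm_num, rfl⟩
  have hfcomp : IsCompact ((fun y => |f y|) '' Set.Icc (-1 : ℝ) 1) :=
    isCompact_Icc.image hf.abs
  have hfb : ∀ y, |f y| ≤ sSup ((fun y => |f y|) '' Set.Icc (-1 : ℝ) 1) := by
    intro y
    refine le_csSup hfcomp.bddAbove (hper (fun y => |f y|) ?_ y)
    intro z
    simp only [hfper z]
  have hm : 0 < sInf (E '' Set.Icc (-1 : ℝ) 1) := by
    obtain ⟨z, -, hz⟩ := hEcomp.sInf_mem hEne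
    rw [← hz]
    exact Real.exp_pos _
  set m := sInf (E '' Set.Icc (-1 : ℝ) 1) with hmdef
  set S := sSup (E '' Set.Icc (-1 : ℝ) 1) with hSdef
  have key : ∀ k : ℕ, k ≤ Nt → ∀ i,
      m * Real.exp (-(k * (Δt * G / lam))) ≤ Ψ i (Nt - k) ∧ Ψ i (Nt - k) ≤ S := by
    intro k
    induction k with
    | zero =>
      intro _ i
      have hmem := hper E hEper (x i)
      have h1 : Ψ i Nt = E (x i) := hterm i
      simp only [Nat.cast_zero, zero_mul, neg_zero, Real.exp_zero, mul_one, Nat.sub_zero, h1]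
      exact ⟨csInf_le hEcomp.bddBelow hmem, le_csSup hEcomp.bddAbove hmem⟩
    | succ k ih =>
      intro hk i
      have ih := ih (by omega)
      have hs := hscheme (Nt - k) (by omega) (by omega) i
      have e : Nt - k - 1 = Nt - (k + 1) := by omega
      rw [e] at hs
      have hgi := hg (x i) (M i (Nt - k))
      have hfi := mul_le_mul_of_nonneg_left (hfb (x i)) hα0.le
      have habs : max (f (x i)) 0 - min (f (x i)) 0 = |f (x i)| := by
        rcases le_total 0 (f (x i)) with h | h
        · simp [h, abs_of_nonneg h]
        · simp [h, abs_of_nonpos h]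
      have hβν : 0 < β * ν := mul_pos hβ0 hν
      have := stmt3_step (α * max (f (x i)) 0 + β * ν)
        (1 - α * (max (f (x i)) 0 - min (f (x i)) 0) - 2 * β * ν)
        (-(α * min (f (x i)) 0) + β * ν)
        (Δt * g (x i) (M i (Nt - k)) / lam) (Δt * G / lam) (Ψ i (Nt - (k + 1)))
        (Ψ (i + 1) (Nt - k)) (Ψ i (Nt - k)) (Ψ (i - 1) (Nt - k))
        (m * Real.exp (-(k * (Δt * G / lam)))) S
        (by have := mul_nonneg hα0.le (le_max_right (f (x i)) 0); linarith)
        (by rw [habs]; linarith)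
        (by
          have := mul_nonpos_of_nonneg_of_nonpos hα0.le (min_le_right (f (x i)) 0)
          linarith)
        (by ring)
        (div_nonneg (mul_nonneg hΔt0.le hgi.1) hlam.le)
        (by have := hgi.2; gcongr)
        (by positivity)
        (by
          rw [div_eq_iff hΔt0.ne'] at hs
          rw [hα, hβ]
          linear_combination hs)
        (ih _) (ih _) (ih _)
      refine ⟨?_, this.2⟩
      have h1 := this.1
      rw [mul_assoc, ← Real.exp_add] at h1
      convert h1 using 3
      push_cast
      ring
  intro i j hj
  refine ⟨by positivity, ?_, ?_⟩
  · have h := (key (Nt - j) (by omega) i).1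
    rw [Nat.sub_sub_self hj] at h
    refine le_trans ?_ h
    rw [mul_comm]
    refine mul_le_mul_of_nonneg_left (Real.exp_le_exp.mpr ?_) hm.le
    have h2 : ((Nt - j : ℕ) : ℝ) ≤ Nt := by exact_mod_cast Nat.sub_le _ _
    have h3 : (0 : ℝ) ≤ Δt * G / lam := by positivity
    have h4 := mul_le_mul_of_nonneg_right h2 h3
    have h5 : (Nt : ℝ) * (Δt * G / lam) = T / lam * G := by
      rw [hΔt]; field_simp
    linarith
  · have h := (key (Nt - j) (by omega) i).2
    rwa [Nat.sub_sub_self hj] at h
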